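/- The closed imaginary cone I of a Coxeter system equals {0} if and only if the Coxeter group W is finite. -/

import Mathlib

noncomputable def coxEntry {B : Type*} (M : CoxeterMatrix B) (s t : B) : ℝ :=
  if M s t = 0 then -2 else -2 * Real.cos (Real.pi / (M s t))

noncomputable def coxForm {B : Type*} [Fintype B] (M : CoxeterMatrix B) (v w : B → ℝ) : ℝ :=
  ∑ s, ∑ t, v s * w t * coxEntry M s t

/-- The simple root `α_s` in `RΛ ≅ (B → ℝ)`. -/
noncomputable def simpleRoot {B : Type*} [DecidableEq B] (s : B) : B → ℝ := Pi.single s 1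

/-- The set of real roots: the `W`-orbit of the simple roots under the Tits representation. -/
def rootSet {B : Type*} [DecidableEq B] {W : Type*} [Group W]
    (ρ : W →* ((B → ℝ) ≃ₗ[ℝ] (B → ℝ))) : Set (B → ℝ) :=
  {v | ∃ (w : W) (s : B), v = ρ w (simpleRoot s)}

/-- The set of positive real roots. -/
def posRootSet {B : Type*} [DecidableEq B] {W : Type*} [Group W]
    (ρ : W →* ((B → ℝ) ≃ₗ[ℝ] (B → ℝ))) : Set (B → ℝ) :=
  {v ∈ rootSet ρ | ∀ i, 0 ≤ v i}

/-- The set `K = {v ∈ ℝ_{≥0}Λ : B(v, α_s) ≤ 0 for all s}`. -/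
noncomputable def coneK {B : Type*} [Fintype B] [DecidableEq B] (M : CoxeterMatrix B) :
    Set (B → ℝ) :=
  {v | (∀ i, 0 ≤ v i) ∧ ∀ s, coxForm M v (simpleRoot s) ≤ 0}

/-- The closed imaginary cone `I = closure (W · K)`. -/
noncomputable def imagCone {B : Type*} [Fintype B] [DecidableEq B] (M : CoxeterMatrix B)
    {W : Type*} [Group W] (ρ : W →* ((B → ℝ) ≃ₗ[ℝ] (B → ℝ))) : Set (B → ℝ) :=
  closure {v | ∃ (w : W), ∃ k ∈ coneK M, v = ρ w k}


section CoxHelpers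

set_option linter.unusedSectionVars false

variable {B : Type*} [Fintype B] [DecidableEq B] (M : CoxeterMatrix B)

theorem coxEntry_symm (s t : B) : coxEntry M s t = coxEntry M t s := by
  unfold coxEntry
  rw [M.symmetric s t]

theorem coxEntry_diag (s : B) : coxEntry M s s = 2 := by
  unfold coxEntry
  simp

theorem coxEntry_off (s t : B) (h : s ≠ t) : coxEntry M s t ≤ 0 := by
  unfold coxEntry
  split_ifs with h0
  · norm_num
  · have h1 : M s t ≠ 1 := M.off_diagonal s t h
    have h2 : 2 ≤ M s t := by omega
    have h3 : (2 : ℝ) ≤ (M s t : ℝ) := by exact_mod_cast h2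
    have hc : 0 ≤ Real.cos (Real.pi / (M s t)) := by
      apply Real.cos_nonneg_of_neg_pi_div_two_le_of_le
      · have : 0 ≤ Real.pi / (M s t) := by positivity
        linarith [Real.pi_pos]
      · exact div_le_div_of_nonneg_left Real.pi_pos.le (by norm_num) h3
    linarith

theorem coxForm_add_left (u v w : B → ℝ) :
    coxForm M (u + v) w = coxForm M u w + coxForm M v w := by
  simp only [coxForm, Pi.add_apply, ← Finset.sum_add_distrib]
  refine Finset.sum_congr rfl fun i _ => Finset.sum_congr rfl fun j _ => by ring

theorem coxForm_smul_left (c : ℝ) (v w : B → ℝ) :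
    coxForm M (c • v) w = c * coxForm M v w := by
  simp only [coxForm, Pi.smul_apply, smul_eq_mul, Finset.mul_sum]
  refine Finset.sum_congr rfl fun i _ => Finset.sum_congr rfl fun j _ => by ring

theorem coxForm_comm (v w : B → ℝ) : coxForm M v w = coxForm M w v := by
  unfold coxForm
  rw [Finset.sum_comm]
  refine Finset.sum_congr rfl fun i _ => Finset.sum_congr rfl fun j _ => ?_
  rw [coxEntry_symm M j i]; ring

theorem coxForm_add_right (u v w : B → ℝ) :
    coxForm M w (u + v) = coxForm M w u + coxForm M w v := by
  rw [coxForm_comm, coxForm_add_left, coxForm_comm M u, coxForm_comm M v]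

theorem coxForm_smul_right (c : ℝ) (v w : B → ℝ) :
    coxForm M w (c • v) = c * coxForm M w v := by
  rw [coxForm_comm, coxForm_smul_left, coxForm_comm M v]

theorem coxForm_sub_left (u v w : B → ℝ) :
    coxForm M (u - v) w = coxForm M u w - coxForm M v w := by
  have : u - v = u + (-1 : ℝ) • v := by ext; simp; ring
  rw [this, coxForm_add_left, coxForm_smul_left]; ring

theorem coxForm_sub_right (u v w : B → ℝ) :
    coxForm M w (u - v) = coxForm M w u - coxForm M w v := by
  rw [coxForm_comm, coxForm_sub_left, coxForm_comm M u, coxForm_comm M v]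

theorem coxForm_simple_simple (s t : B) :
    coxForm M (simpleRoot s) (simpleRoot t) = coxEntry M s t := by
  unfold coxForm simpleRoot
  rw [Finset.sum_eq_single s, Finset.sum_eq_single t]
  · simp
  · intro b _ hb; simp [hb]
  · simp
  · intro b _ hb; simp [hb]
  · simp

theorem coxForm_eq_sum (v w : B → ℝ) :
    coxForm M v w = ∑ s, w s * coxForm M v (simpleRoot s) := by
  have h : ∀ s, coxForm M v (simpleRoot s) = ∑ i, v i * coxEntry M i s := by
    intro s
    unfold coxForm simpleRoot
    refine Finset.sum_congr rfl fun i _ => ?_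
    rw [Finset.sum_eq_single s]
    · simp
    · intro b _ hb; simp [hb]
    · simp
  simp_rw [h, Finset.mul_sum]
  unfold coxForm
  rw [Finset.sum_comm]
  refine Finset.sum_congr rfl fun i _ => Finset.sum_congr rfl fun j _ => by ring

theorem coxForm_continuous : Continuous fun v : B → ℝ => coxForm M v v := by
  unfold coxForm
  fun_prop

/-! ### Positivity from vanishing of `K` -/

theorem coxForm_pos_of_coneK (hK : ∀ v ∈ coneK M, v = 0) :
    ∃ l : ℝ, 0 < l ∧ ∀ v : B → ℝ, l * ∑ i, v i ^ 2 ≤ coxForm M v v := by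
  let S : Set (B → ℝ) := {v | ∑ i, v i ^ 2 = 1}
  have hSc : IsClosed S := isClosed_eq (by fun_prop) continuous_const
  have hSb : Bornology.IsBounded S := by
    refine (Metric.isBounded_closedBall (x := (0 : B → ℝ)) (r := 1)).subset ?_
    intro v hv
    rw [mem_closedBall_zero_iff, pi_norm_le_iff_of_nonneg zero_le_one]
    intro i
    have hv' : ∑ i, v i ^ 2 = 1 := hv
    have : v i ^ 2 ≤ 1 := by
      rw [← hv']
      exact Finset.single_le_sum (f := fun i => v i ^ 2) (fun _ _ => sq_nonneg _)
        (Finset.mem_univ i)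
    rw [Real.norm_eq_abs]
    exact (sq_le_one_iff_abs_le_one _).1 this
  have hScomp : IsCompact S := Metric.isCompact_of_isClosed_isBounded hSc hSb
  -- scaling
  have hscale : ∀ l : ℝ, (∀ v ∈ S, l ≤ coxForm M v v) →
      ∀ v : B → ℝ, l * ∑ i, v i ^ 2 ≤ coxForm M v v := by
    intro l hl v
    by_cases h0 : ∑ i, v i ^ 2 = 0
    · have hv : v = 0 := by
        ext i
        have := (Finset.sum_eq_zero_iff_of_nonneg (fun i _ => sq_nonneg (v i))).1 h0 i
          (Finset.mem_univ i)
        simpa using this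
      subst hv
      simp [coxForm]
    · have hp : 0 < ∑ i, v i ^ 2 :=
        lt_of_le_of_ne (Finset.sum_nonneg fun i _ => sq_nonneg _) (Ne.symm h0)
      set r := Real.sqrt (∑ i, v i ^ 2) with hr
      have hr2 : r ^ 2 = ∑ i, v i ^ 2 := Real.sq_sqrt hp.le
      have hrp : 0 < r := Real.sqrt_pos.2 hp
      have hmem : r⁻¹ • v ∈ S := by
        change ∑ i, (r⁻¹ • v) i ^ 2 = 1
        simp only [Pi.smul_apply, smul_eq_mul, mul_pow, ← Finset.mul_sum]
        rw [← hr2]; field_simp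
      have := hl _ hmem
      rw [coxForm_smul_left, coxForm_smul_right] at this
      rw [← hr2]
      have h2 : coxForm M v v = r ^ 2 * (r⁻¹ * (r⁻¹ * coxForm M v v)) := by field_simp
      rw [h2, mul_comm l]
      exact mul_le_mul_of_nonneg_left this (sq_nonneg _)
  rcases S.eq_empty_or_nonempty with hSe | hSn
  · refine ⟨1, one_pos, hscale 1 ?_⟩
    intro v hv; rw [hSe] at hv; exact hv.elim
  · obtain ⟨x, hxS, hx⟩ := hScomp.exists_isMinOn hSn (coxForm_continuous M).continuousOn
    have hmin : ∀ v ∈ S, coxForm M x x ≤ coxForm M v v := fun v hv => hx hv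
    have hmin' := hscale _ hmin
    set l := coxForm M x x with hl
    by_cases hlp : 0 < l
    · exact ⟨l, hlp, hmin'⟩
    · exfalso
      push Not at hlp
      let y : B → ℝ := fun i => |x i|
      have hyS : ∑ i, y i ^ 2 = 1 := by
        have : ∑ i, x i ^ 2 = 1 := hxS
        simpa [y, sq_abs] using this
      have hyq : coxForm M y y ≤ l := by
        rw [hl]
        unfold coxForm
        refine Finset.sum_le_sum fun i _ => Finset.sum_le_sum fun j _ => ?_
        by_cases hij : i = j
        · subst hij; simp [y]
        · have h1 := coxEntry_off M i j hij
          have h2 : x i * x j ≤ y i * y j := by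
            simp only [y, ← abs_mul]; exact le_abs_self _
          exact mul_le_mul_of_nonpos_right h2 h1
      have hyb : ∀ s, coxForm M y (simpleRoot s) = l * y s := by
        intro s
        set b := coxForm M y (simpleRoot s) - l * y s with hb
        have key : ∀ t : ℝ, 0 ≤ 2 * t * b + t ^ 2 * (2 - l) := by
          intro t
          have h1 := hmin' (y + t • simpleRoot s)
          have h2 : ∑ i, (y + t • simpleRoot s) i ^ 2 = 1 + 2 * t * y s + t ^ 2 := by
            rw [← hyS]
            have : ∀ i, (y + t • simpleRoot s) i ^ 2
                = y i ^ 2 + 2 * t * (y i * simpleRoot s i) + t ^ 2 * (simpleRoot s i) ^ 2 := by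
              intro i; simp; ring
            simp_rw [this, Finset.sum_add_distrib, ← Finset.mul_sum]
            simp [simpleRoot, Pi.single_apply]
          rw [h2, coxForm_add_left, coxForm_add_right, coxForm_add_right, coxForm_smul_left,
            coxForm_smul_left, coxForm_smul_right, coxForm_smul_right, coxForm_simple_simple,
            coxEntry_diag, coxForm_comm M (simpleRoot s) y] at h1
          rw [hb]
          nlinarith
        have h2l : 0 < 2 - l := by linarith
        have h3 := key (-b / (2 - l))
        have h4 : 2 * (-b / (2 - l)) * b + (-b / (2 - l)) ^ 2 * (2 - l) = -(b ^ 2 / (2 - l)) := by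
          field_simp; ring
        rw [h4] at h3
        have h5 : b ^ 2 / (2 - l) = 0 := le_antisymm (by linarith) (by positivity)
        have h6 : b = 0 := by
          rcases div_eq_zero_iff.1 h5 with h | h
          · simpa using h
          · linarith
        linarith
      have hyK : y ∈ coneK M := by
        refine ⟨fun i => abs_nonneg _, fun s => ?_⟩
        rw [hyb]
        exact mul_nonpos_of_nonpos_of_nonneg hlp (abs_nonneg _)
      have := hK y hyK
      rw [this] at hyS
      simp at hyS

/-! ### Dihedral computation -/

/-- Chebyshev-like sequence. -/
noncomputable def chebSeq (c : ℝ) : ℕ → ℝ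
  | 0 => 0
  | 1 => 1
  | (n + 2) => c * chebSeq c (n + 1) - chebSeq c n

theorem chebSeq_two (n : ℕ) : chebSeq 2 n = n := by
  induction n using Nat.twoStepInduction with
  | zero => simp [chebSeq]
  | one => simp [chebSeq]
  | more n h1 h2 => rw [chebSeq, h1, h2]; push_cast; ring

theorem chebSeq_cos (θ : ℝ) (n : ℕ) :
    Real.sin θ * chebSeq (2 * Real.cos θ) n = Real.sin (n * θ) := by
  induction n using Nat.twoStepInduction with
  | zero => simp [chebSeq]
  | one => simp [chebSeq]
  | more n h1 h2 =>
    rw [chebSeq, mul_sub, mul_left_comm, h1, h2]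
    push_cast
    have e1 : ((n : ℝ) + 2) * θ = (n + 1) * θ + θ := by ring
    have e2 : (n : ℝ) * θ = (n + 1) * θ - θ := by ring
    rw [e1, e2, Real.sin_add, Real.sin_sub]; ring

theorem chebSeq_nonneg (s t : B) (h : s ≠ t) (k : ℕ) (hk : M s t ≠ 0 → k ≤ M s t) :
    0 ≤ chebSeq (-coxEntry M s t) k := by
  unfold coxEntry
  split_ifs with h0
  · rw [neg_neg, chebSeq_two]; positivity
  · have h1 : M s t ≠ 1 := M.off_diagonal s t h
    have h2 : 2 ≤ M s t := by omega
    have h3 : (2 : ℝ) ≤ (M s t : ℝ) := by exact_mod_cast h2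
    have hk' : (k : ℝ) ≤ (M s t : ℝ) := by exact_mod_cast hk h0
    set θ := Real.pi / (M s t) with hθ
    have e : -(-2 * Real.cos θ) = 2 * Real.cos θ := by ring
    rw [e]
    have hMp : (0 : ℝ) < M s t := by linarith
    have hθ0 : 0 < θ := div_pos Real.pi_pos hMp
    have hθM : M s t * θ = Real.pi := by rw [hθ]; field_simp
    have hsin : 0 < Real.sin θ := Real.sin_pos_of_pos_of_lt_pi hθ0 (by nlinarith)
    have hks : 0 ≤ Real.sin (k * θ) :=
      Real.sin_nonneg_of_nonneg_of_le_pi (by positivity)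
        (by rw [← hθM]; exact mul_le_mul_of_nonneg_right hk' hθ0.le)
    rw [← chebSeq_cos] at hks
    exact nonneg_of_mul_nonneg_right hks hsin

variable {W : Type*} [Group W] (cs : CoxeterSystem M W)
    (ρ : W →* ((B → ℝ) ≃ₗ[ℝ] (B → ℝ)))

theorem rho_mul_apply (a b : W) (v : B → ℝ) : ρ (a * b) v = ρ a (ρ b v) := by
  rw [map_mul]; rfl

theorem rho_simple_root (hρ : ∀ (s : B) (v : B → ℝ),
      ρ (cs.simple s) v = v - coxForm M (simpleRoot s) v • simpleRoot s) (s : B) :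
    ρ (cs.simple s) (simpleRoot s) = - simpleRoot s := by
  rw [hρ, coxForm_simple_simple, coxEntry_diag, two_smul]; abel

theorem rho_alternating (hρ : ∀ (s : B) (v : B → ℝ),
      ρ (cs.simple s) v = v - coxForm M (simpleRoot s) v • simpleRoot s) (s t : B) (k : ℕ) :
    ρ (cs.wordProd (CoxeterSystem.alternatingWord s t k)) (simpleRoot s) =
      chebSeq (-coxEntry M s t) (if Even k then k + 1 else k) • simpleRoot s +
      chebSeq (-coxEntry M s t) (if Even k then k else k + 1) • simpleRoot t := by
  induction k with
  | zero => simp [CoxeterSystem.alternatingWord, chebSeq]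
  | succ k ih =>
    rw [CoxeterSystem.alternatingWord_succ', CoxeterSystem.wordProd_cons, rho_mul_apply, ih]
    have hc : chebSeq (-coxEntry M s t) (k + 2)
      = (-coxEntry M s t) * chebSeq (-coxEntry M s t) (k + 1) - chebSeq (-coxEntry M s t) k := rfl
    by_cases hk : Even k
    · have hk' : ¬ Even (k + 1) := by simpa [Nat.even_add_one] using hk
      simp only [hk, hk', if_true, if_false]
      rw [hρ, coxForm_add_right, coxForm_smul_right, coxForm_smul_right, coxForm_simple_simple,
        coxForm_simple_simple, coxEntry_diag, hc, coxEntry_symm M t s]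
      ext i; simp; ring
    · have hk' : Even (k + 1) := by simpa [Nat.even_add_one] using hk
      simp only [hk, hk', if_true, if_false]
      rw [hρ, coxForm_add_right, coxForm_smul_right, coxForm_smul_right, coxForm_simple_simple,
        coxForm_simple_simple, coxEntry_diag, hc]
      ext i; simp; ring

/-- The key theorem: if `ℓ(ws) > ℓ(w)` then `w α_s ≥ 0`. -/
theorem root_nonneg (hρ : ∀ (s : B) (v : B → ℝ),
      ρ (cs.simple s) v = v - coxForm M (simpleRoot s) v • simpleRoot s) :
    ∀ (n : ℕ) (w : W) (s : B), cs.length w = n → ¬ cs.IsRightDescent w s →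
      ∀ i, 0 ≤ ρ w (simpleRoot s) i := by
  intro n
  induction n using Nat.strong_induction_on with
  | _ n IH =>
  intro w s hn hs
  by_cases hw : w = 1
  · subst hw
    intro i
    by_cases h : i = s
    · subst h; simp [simpleRoot]
    · simp [simpleRoot, h]
  obtain ⟨t, ht⟩ := cs.exists_rightDescent_of_ne_one hw
  have hst : s ≠ t := by rintro rfl; exact hs ht
  classical
  let P : ℕ → Prop := fun k => ∃ v : W,
    w = v * cs.wordProd (CoxeterSystem.alternatingWord s t k) ∧ cs.length v + k = cs.length w
  have hP1 : P 1 := by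
    refine ⟨w * cs.simple t, ?_, ?_⟩
    · simp [CoxeterSystem.alternatingWord]
    · exact cs.isRightDescent_iff.1 ht
  have hbd : ∀ k, P k → k ≤ cs.length w := by
    rintro k ⟨v, -, h⟩; omega
  set k := Nat.findGreatest P (cs.length w) with hkdef
  have hPk : P k := Nat.findGreatest_spec (hbd 1 hP1) hP1
  have hk1 : 1 ≤ k := Nat.le_findGreatest (hbd 1 hP1) hP1
  have hmax : ¬ P (k + 1) := by
    intro h
    have := Nat.le_findGreatest (hbd _ h) h
    omega
  obtain ⟨v, hv, hlen⟩ := hPk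
  -- the letter that would extend is not a descent of v
  have hd1 : ¬ cs.IsRightDescent v (if Even k then t else s) := by
    intro h
    apply hmax
    refine ⟨v * cs.simple (if Even k then t else s), ?_, ?_⟩
    · rw [CoxeterSystem.alternatingWord_succ', CoxeterSystem.wordProd_cons, mul_assoc,
        cs.simple_mul_simple_cancel_left]
      exact hv
    · have := cs.isRightDescent_iff.1 h
      omega
  have hd2 : ¬ cs.IsRightDescent v (if Even k then s else t) := by
    intro h
    have h1 := cs.isRightDescent_iff.1 h
    obtain ⟨j, hj⟩ : ∃ j, k = j + 1 := ⟨k - 1, by omega⟩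
    have hpar : (if Even j then t else s) = (if Even k then s else t) := by
      rw [hj]
      by_cases hje : Even j <;> simp [Nat.even_add_one, hje]
    have h2 : w = (v * cs.simple (if Even k then s else t)) *
        cs.wordProd (CoxeterSystem.alternatingWord s t j) := by
      rw [← hpar, mul_assoc, ← CoxeterSystem.wordProd_cons,
        ← CoxeterSystem.alternatingWord_succ', ← hj]
      exact hv
    have h3 := cs.length_mul_le (v * cs.simple (if Even k then s else t))
      (cs.wordProd (CoxeterSystem.alternatingWord s t j))
    rw [← h2] at h3
    have h4 := cs.length_wordProd_le (CoxeterSystem.alternatingWord s t j)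
    rw [CoxeterSystem.length_alternatingWord] at h4
    omega
  have hvs : ¬ cs.IsRightDescent v s ∧ ¬ cs.IsRightDescent v t := by
    by_cases hk : Even k
    · simp only [hk, if_true] at hd1 hd2; exact ⟨hd2, hd1⟩
    · simp only [hk, if_false] at hd1 hd2; exact ⟨hd1, hd2⟩
  have hkM : M s t ≠ 0 → k + 1 ≤ M s t := by
    intro hM
    by_contra hcon
    have h1 : k + 1 > M t s := by rw [M.symmetric t s]; omega
    have h2 := cs.not_isReduced_alternatingWord t s (by rwa [M.symmetric t s]) h1
    have h3 := cs.length_wordProd_le (CoxeterSystem.alternatingWord t s (k + 1))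
    have h4 := cs.not_isRightDescent_iff.1 hs
    have h5 : w * cs.simple s =
        v * cs.wordProd (CoxeterSystem.alternatingWord t s (k + 1)) := by
      rw [CoxeterSystem.alternatingWord_succ, List.concat_eq_append,
        CoxeterSystem.wordProd_append, ← mul_assoc, ← hv]
      simp
    have h6 := cs.length_mul_le v (cs.wordProd (CoxeterSystem.alternatingWord t s (k + 1)))
    rw [← h5] at h6
    unfold CoxeterSystem.IsReduced at h2
    rw [CoxeterSystem.length_alternatingWord] at h2 h3
    omega
  have hIs := IH (cs.length v) (by omega) v s rfl hvs.1
  have hIt := IH (cs.length v) (by omega) v t rfl hvs.2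
  intro i
  have hfin : ρ w (simpleRoot s) =
      chebSeq (-coxEntry M s t) (if Even k then k + 1 else k) • ρ v (simpleRoot s) +
      chebSeq (-coxEntry M s t) (if Even k then k else k + 1) • ρ v (simpleRoot t) := by
    conv_lhs => rw [hv]
    rw [rho_mul_apply, rho_alternating M cs ρ hρ, map_add, map_smul, map_smul]
  rw [hfin]
  have hA : 0 ≤ chebSeq (-coxEntry M s t) (if Even k then k + 1 else k) := by
    apply chebSeq_nonneg M s t hst
    intro h; have := hkM h; split_ifs <;> omega
  have hB : 0 ≤ chebSeq (-coxEntry M s t) (if Even k then k else k + 1) := by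
    apply chebSeq_nonneg M s t hst
    intro h; have := hkM h; split_ifs <;> omega
  exact add_nonneg (mul_nonneg hA (hIs i)) (mul_nonneg hB (hIt i))

theorem root_nonpos (hρ : ∀ (s : B) (v : B → ℝ),
      ρ (cs.simple s) v = v - coxForm M (simpleRoot s) v • simpleRoot s)
    (w : W) (s : B) (h : cs.IsRightDescent w s) (i : B) :
    ρ w (simpleRoot s) i ≤ 0 := by
  have h1 := root_nonneg M cs ρ hρ _ (w * cs.simple s) s rfl
    (cs.isRightDescent_iff_not_isRightDescent_mul.1 h) i
  rw [rho_mul_apply, rho_simple_root M cs ρ hρ, map_neg, Pi.neg_apply] at h1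
  linarith

theorem coxForm_invariant (hρ : ∀ (s : B) (v : B → ℝ),
      ρ (cs.simple s) v = v - coxForm M (simpleRoot s) v • simpleRoot s)
    (w : W) : ∀ (u v : B → ℝ), coxForm M (ρ w u) (ρ w v) = coxForm M u v := by
  induction w using cs.simple_induction_left with
  | one => intro u v; simp
  | mul_simple_left w i ih =>
    intro u v
    rw [rho_mul_apply, rho_mul_apply, ← ih u v, hρ, hρ]
    simp only [coxForm_sub_left, coxForm_sub_right, coxForm_smul_left, coxForm_smul_right,
      coxForm_simple_simple, coxEntry_diag]
    rw [coxForm_comm M (ρ w u) (simpleRoot i)]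
    ring

theorem finite_of_posDef (hρ : ∀ (s : B) (v : B → ℝ),
      ρ (cs.simple s) v = v - coxForm M (simpleRoot s) v • simpleRoot s)
    (l : ℝ) (hl : 0 < l) (hpd : ∀ v : B → ℝ, l * ∑ i, v i ^ 2 ≤ coxForm M v v) :
    Finite W := by
  have hnn : ∀ v, 0 ≤ coxForm M v v := fun v =>
    le_trans (mul_nonneg hl.le (Finset.sum_nonneg fun i _ => sq_nonneg _)) (hpd v)
  -- the vector pairing to one with every simple root
  obtain ⟨x, hx⟩ : ∃ x : B → ℝ, ∀ s, coxForm M x (simpleRoot s) = 1 := by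
    let L : (B → ℝ) →ₗ[ℝ] (B → ℝ) :=
      { toFun := fun v s => coxForm M v (simpleRoot s)
        map_add' := fun u v => by ext s; exact coxForm_add_left M u v _
        map_smul' := fun c v => by ext s; exact coxForm_smul_left M c v _ }
    have hinj : Function.Injective L := by
      rw [injective_iff_map_eq_zero]
      intro v hv
      have h1 : coxForm M v v = 0 := by
        rw [coxForm_eq_sum]
        refine Finset.sum_eq_zero fun s _ => ?_
        have : coxForm M v (simpleRoot s) = 0 := congrFun hv s
        rw [this, mul_zero]
      have h2 := hpd v
      rw [h1] at h2
      have h0 : ∑ i, v i ^ 2 = 0 :=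
        le_antisymm (by by_contra h; push Not at h; nlinarith)
          (Finset.sum_nonneg fun i _ => sq_nonneg _)
      ext i
      have := (Finset.sum_eq_zero_iff_of_nonneg (fun i _ => sq_nonneg (v i))).1 h0 i
        (Finset.mem_univ i)
      simpa using this
    obtain ⟨x, hx⟩ := (LinearMap.injective_iff_surjective.1 hinj) (fun _ => 1)
    exact ⟨x, fun s => congrFun hx s⟩
  have hsep1 : ∀ u : W, u ≠ 1 → 1 / 2 ≤ coxForm M (ρ u x - x) (ρ u x - x) := by
    intro u hu
    obtain ⟨s, hs⟩ := cs.exists_rightDescent_of_ne_one (inv_ne_one.2 hu)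
    have h1 : coxForm M (ρ u x) (simpleRoot s) ≤ 0 := by
      have h2 := coxForm_invariant M cs ρ hρ u x (ρ u⁻¹ (simpleRoot s))
      rw [← rho_mul_apply, mul_inv_cancel, map_one] at h2
      change coxForm M (ρ u x) (simpleRoot s) = _ at h2
      rw [h2, coxForm_eq_sum]
      refine Finset.sum_nonpos fun i _ => ?_
      rw [hx, mul_one]
      exact root_nonpos M cs ρ hρ _ s hs i
    set d := ρ u x - x with hd
    have h3 : coxForm M d (simpleRoot s) ≤ -1 := by
      rw [hd, coxForm_sub_left, hx]; linarith
    set b := coxForm M d (simpleRoot s) with hb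
    have h4 := hnn (d - (b / 2) • simpleRoot s)
    simp only [coxForm_sub_left, coxForm_sub_right, coxForm_smul_left, coxForm_smul_right,
      coxForm_simple_simple, coxEntry_diag] at h4
    rw [coxForm_comm M (simpleRoot s) d, ← hb] at h4
    nlinarith
  have hsep : ∀ w w' : W, w ≠ w' → 1 / 2 ≤ coxForm M (ρ w x - ρ w' x) (ρ w x - ρ w' x) := by
    intro w w' hne
    have h1 := hsep1 (w'⁻¹ * w) (by
      intro h; exact hne (inv_mul_eq_one.1 h).symm)
    rw [← coxForm_invariant M cs ρ hρ w', map_sub, ← rho_mul_apply, mul_inv_cancel_left] at h1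
    exact h1
  by_contra hfin
  rw [not_finite_iff_infinite] at hfin
  let f := Infinite.natEmbedding W
  let g : ℕ → (B → ℝ) := fun n => ρ (f n) x
  have hbdd : ∀ n, g n ∈ Metric.closedBall (0 : B → ℝ) (Real.sqrt (coxForm M x x / l)) := by
    intro n
    rw [mem_closedBall_zero_iff, pi_norm_le_iff_of_nonneg (Real.sqrt_nonneg _)]
    intro i
    rw [Real.norm_eq_abs]
    apply Real.abs_le_sqrt
    rw [le_div_iff₀ hl]
    have h1 := hpd (g n)
    rw [show coxForm M (g n) (g n) = coxForm M x x from coxForm_invariant M cs ρ hρ _ _ _] at h1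
    have h2 : g n i ^ 2 ≤ ∑ i, g n i ^ 2 :=
      Finset.single_le_sum (f := fun i => g n i ^ 2) (fun _ _ => sq_nonneg _) (Finset.mem_univ i)
    nlinarith
  obtain ⟨a, -, φ, hφ, hlim⟩ := tendsto_subseq_of_bounded
    (Metric.isBounded_closedBall (x := (0 : B → ℝ)) (r := Real.sqrt (coxForm M x x / l))) hbdd
  have hlim2 : Filter.Tendsto (fun n => (g ∘ φ) (n + 1) - (g ∘ φ) n) Filter.atTop (nhds 0) := by
    have := (hlim.comp (Filter.tendsto_add_atTop_nat 1)).sub hlim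
    simpa using this
  have hlim3 := ((coxForm_continuous M).tendsto 0).comp hlim2
  have h0 : coxForm M (0 : B → ℝ) 0 = 0 := by simp [coxForm]
  rw [h0] at hlim3
  have := ge_of_tendsto' hlim3 (b := 1 / 2) (fun n => by
    apply hsep
    intro h
    have := hφ.injective (f.injective h)
    omega)
  norm_num at this

theorem coneK_zero_of_finite (hρ : ∀ (s : B) (v : B → ℝ),
      ρ (cs.simple s) v = v - coxForm M (simpleRoot s) v • simpleRoot s)
    (hfin : Finite W) : ∀ v ∈ coneK M, v = 0 := by
  intro v hv
  have := Fintype.ofFinite W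
  let Q : (B → ℝ) → (B → ℝ) → ℝ := fun u v => ∑ w : W, ∑ i, ρ w u i * ρ w v i
  have hQinv : ∀ (a : W) u v, Q (ρ a u) (ρ a v) = Q u v := by
    intro a u v
    simp only [Q, ← rho_mul_apply]
    exact Equiv.sum_comp (Equiv.mulRight a) (fun w => ∑ i, ρ w u i * ρ w v i)
  have hQsub : ∀ u u' v, Q (u - u') v = Q u v - Q u' v := by
    intro u u' v
    simp only [Q, map_sub, Pi.sub_apply, sub_mul, Finset.sum_sub_distrib]
  have hQsmul : ∀ (c : ℝ) u v, Q (c • u) v = c * Q u v := by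
    intro c u v
    simp only [Q, map_smul, Pi.smul_apply, smul_eq_mul, Finset.mul_sum, mul_assoc]
  have hQneg : ∀ u v, Q u (-v) = - Q u v := by
    intro u v
    simp only [Q, map_neg, Pi.neg_apply, mul_neg, Finset.sum_neg_distrib]
  have hQnn : ∀ u, 0 ≤ Q u u := fun u =>
    Finset.sum_nonneg fun w _ => Finset.sum_nonneg fun i _ => mul_self_nonneg _
  have hQs : ∀ s, Q v (simpleRoot s) ≤ 0 := by
    intro s
    have h1 := hQinv (cs.simple s) v (simpleRoot s)
    rw [rho_simple_root M cs ρ hρ, hρ, hQneg, hQsub, hQsmul] at h1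
    have h2 := hv.2 s
    rw [coxForm_comm] at h2
    nlinarith [hQnn (simpleRoot s), mul_nonneg (neg_nonneg.2 h2) (hQnn (simpleRoot s))]
  have hvsum : v = ∑ s, v s • simpleRoot s := by
    ext i; simp [simpleRoot, Pi.single_apply]
  have hQv : Q v v = ∑ s, v s * Q v (simpleRoot s) := by
    let T : (B → ℝ) →ₗ[ℝ] ℝ :=
      { toFun := fun u => Q v u
        map_add' := fun a b => by
          simp only [Q, map_add, Pi.add_apply, mul_add, Finset.sum_add_distrib]
        map_smul' := fun c a => by
          simp only [Q, map_smul, Pi.smul_apply, smul_eq_mul, Finset.mul_sum, RingHom.id_apply,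
            mul_left_comm] }
    change T v = ∑ s, v s * T (simpleRoot s)
    conv_lhs => rw [hvsum]
    simp only [map_sum, map_smul, smul_eq_mul]
  have hQle : Q v v ≤ 0 := by
    rw [hQv]
    exact Finset.sum_nonpos fun s _ => mul_nonpos_of_nonneg_of_nonpos (hv.1 s) (hQs s)
  have h1 : ∑ i, v i * v i ≤ Q v v := by
    have := Finset.single_le_sum (f := fun w : W => ∑ i, ρ w v i * ρ w v i)
      (fun w _ => Finset.sum_nonneg fun i _ => mul_self_nonneg _) (Finset.mem_univ 1)
    simpa using this
  have h0 : ∑ i, v i * v i = 0 :=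
    le_antisymm (h1.trans hQle) (Finset.sum_nonneg fun i _ => mul_self_nonneg _)
  ext i
  have := (Finset.sum_eq_zero_iff_of_nonneg (fun i _ => mul_self_nonneg (v i))).1 h0 i
    (Finset.mem_univ i)
  simpa using this

end CoxHelpers

theorem imagCone_eq_zero_iff_finite
    {B : Type*} [Fintype B] [DecidableEq B] (M : CoxeterMatrix B)
    {W : Type*} [Group W] (cs : CoxeterSystem M W)
    (ρ : W →* ((B → ℝ) ≃ₗ[ℝ] (B → ℝ)))
    (hρ : ∀ (s : B) (v : B → ℝ),
      ρ (cs.simple s) v = v - coxForm M (simpleRoot s) v • simpleRoot s) :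
    imagCone M ρ = {0} ↔ Finite W := by
  constructor
  · intro h
    have hK : ∀ v ∈ coneK M, v = 0 := by
      intro v hv
      have : v ∈ imagCone M ρ := subset_closure ⟨1, v, hv, by simp⟩
      rw [h] at this
      exact this
    obtain ⟨l, hl, hpd⟩ := coxForm_pos_of_coneK M hK
    exact finite_of_posDef M cs ρ hρ l hl hpd
  · intro h
    have hK := coneK_zero_of_finite M cs ρ hρ h
    have hset : {v | ∃ (w : W), ∃ k ∈ coneK M, v = ρ w k} = {0} := by
      ext v
      constructor
      · rintro ⟨w, k, hk, rfl⟩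
        rw [hK k hk]; simp
      · intro hv
        rw [Set.mem_singleton_iff] at hv
        subst hv
        refine ⟨1, 0, ⟨fun i => le_rfl, fun s => ?_⟩, by simp⟩
        simp [coxForm]
    unfold imagCone
    rw [hset, closure_singleton]
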